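/- arXiv:1211.2576 — 2 statements merged into one kernel-verified Lean document; each statement's English description precedes it below -/
import Mathlib

section
/- Let φ be a faithful normal state on a factor M acting standardly on L²(M,φ), and let θ be an equi-modular endomorphism of (M,φ). Then there exists a unique normal *-endomorphism θ⁽²⁾ of B(L²(M,φ)) satisfying θ⁽²⁾(x·j(y)) = θ(x)·j(θ(y))·z for all x,y ∈ M, where z = ∧{p ∈ (θ(M) ∪ j(θ(M)))″ : ran(p) ⊇ {θ(x)1̂_M : x ∈ M}}. -/
set_option synthInstance.maxHeartbeats 400000
set_option maxHeartbeats 1000000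

open scoped InnerProductSpace ComplexConjugate

noncomputable section

namespace Paper

variable {H : Type} [NormedAddCommGroup H] [InnerProductSpace ℂ H] [CompleteSpace H]
variable {H' : Type} [NormedAddCommGroup H'] [InnerProductSpace ℂ H'] [CompleteSpace H']

/-- An operator is a (self-adjoint, idempotent) orthogonal projection. -/
def IsProjection (p : H →L[ℂ] H) : Prop := IsSelfAdjoint p ∧ p * p = p

/-- The vector state determined by a vector `Ω`. -/
def vecState (Ω : H) (x : H →L[ℂ] H) : ℂ := ⟪x Ω, Ω⟫_ℂ

/-- A normal state on a von Neumann algebra, described via its canonical form as a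
countable convex combination of vector states. -/
def IsNormalState (M : Set (H →L[ℂ] H)) (φ : (H →L[ℂ] H) → ℂ) : Prop :=
  ∃ ξ : ℕ → H, (Summable fun n => ‖ξ n‖ ^ 2) ∧ (∑' n, ‖ξ n‖ ^ 2) = 1 ∧
    ∀ x ∈ M, φ x = ∑' n, ⟪x (ξ n), ξ n⟫_ℂ

/-- Normality (complete additivity) of a map between operator algebras: it is `σ`-weakly
continuous, equivalently it preserves sums of orthogonal families of projections lying in the
given domain `S`. -/
def IsNormalMapOn (S : Set (H →L[ℂ] H)) (Θ : (H →L[ℂ] H) → (H' →L[ℂ] H')) : Prop :=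
  ∀ {ι : Type} (p : ι → (H →L[ℂ] H)) (q : H →L[ℂ] H),
    (∀ i, p i ∈ S) → q ∈ S →
    (∀ i, IsProjection (p i)) → (∀ i k, i ≠ k → p i * p k = 0) →
    (∀ ξ : H, HasSum (fun i => p i ξ) (q ξ)) →
    ∀ ξ : H', HasSum (fun i => Θ (p i) ξ) (Θ q ξ)

/-- `Θ` is a `*`-homomorphism on the subset `S` (typically a von Neumann algebra). -/
structure IsStarHomOn (S : Set (H →L[ℂ] H)) (Θ : (H →L[ℂ] H) → (H' →L[ℂ] H')) : Prop where
  map_add : ∀ x ∈ S, ∀ y ∈ S, Θ (x + y) = Θ x + Θ y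
  map_smul : ∀ (c : ℂ), ∀ x ∈ S, Θ (c • x) = c • Θ x
  map_mul : ∀ x ∈ S, ∀ y ∈ S, Θ (x * y) = Θ x * Θ y
  map_star : ∀ x ∈ S, Θ (star x) = star (Θ x)

/-- The (self-adjoint part of the) center of `S` is trivial. -/
def IsFactorSet (S : Set (H →L[ℂ] H)) : Prop :=
  ∀ x ∈ S, (∀ y ∈ S, x * y = y * x) → ∃ c : ℂ, x = c • (1 : H →L[ℂ] H)

/-- A type `I` factor: a factor possessing a minimal projection. -/
def IsTypeIFactorSet (S : Set (H →L[ℂ] H)) : Prop :=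
  IsFactorSet S ∧ ∃ p ∈ S, p ≠ 0 ∧ IsProjection p ∧
    ∀ q ∈ S, IsProjection q → q * p = q → q = 0 ∨ q = p

/-- `z` is the central support of the normal state `φ` of the von Neumann algebra `S`, i.e. the
smallest central projection of full measure. -/
structure IsCentralSupport (S : Set (H →L[ℂ] H)) (φ : (H →L[ℂ] H) → ℂ) (z : H →L[ℂ] H) :
    Prop where
  mem : z ∈ S
  proj : IsProjection z
  central : ∀ y ∈ S, z * y = y * z
  full : φ z = 1
  min : ∀ w ∈ S, IsProjection w → (∀ y ∈ S, w * y = y * w) → φ w = 1 → z * w = z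

/-- The von Neumann algebra generated by a (self-adjoint) set of operators. -/
def vN (S : Set (H →L[ℂ] H)) : Set (H →L[ℂ] H) := Set.centralizer (Set.centralizer S)

/-- Standard form data for a von Neumann algebra `M` with cyclic separating unit vector `Ω`:
`J` is the modular conjugation (an antiunitary involution fixing `Ω`, conjugating `M` onto its
commutant, and positive on the cone `{x j(x) Ω}`), and `j = J (·) J`. -/
structure StandardForm (M : VonNeumannAlgebra H) (Ω : H) (J : H → H)
    (j : (H →L[ℂ] H) → (H →L[ℂ] H)) : Prop where
  unit : ‖Ω‖ = 1
  cyclic : Dense {ξ : H | ∃ x ∈ M, x Ω = ξ}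
  separating : ∀ x ∈ M, x Ω = 0 → x = 0
  Jadd : ∀ ξ η : H, J (ξ + η) = J ξ + J η
  Jsmul : ∀ (c : ℂ) (ξ : H), J (c • ξ) = (starRingEnd ℂ) c • J ξ
  Jinvol : ∀ ξ : H, J (J ξ) = ξ
  Jinner : ∀ ξ η : H, ⟪J ξ, J η⟫_ℂ = ⟪η, ξ⟫_ℂ
  JΩ : J Ω = Ω
  jdef : ∀ (x : H →L[ℂ] H) (ξ : H), j x ξ = J (x (J ξ))
  jmapsTo : ∀ x ∈ M, j x ∈ Set.centralizer (M : Set (H →L[ℂ] H))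
  jsurj : ∀ y ∈ Set.centralizer (M : Set (H →L[ℂ] H)), ∃ x ∈ M, j x = y
  pos : ∀ x ∈ M, 0 ≤ (⟪(x * j x) Ω, Ω⟫_ℂ).re ∧ (⟪(x * j x) Ω, Ω⟫_ℂ).im = 0

/-- A unital `*`-endomorphism of `M` preserving the (faithful, normal) vector state of `Ω`. -/
structure StateEndo (M : VonNeumannAlgebra H) (Ω : H)
    (θ : (H →L[ℂ] H) → (H →L[ℂ] H)) : Prop where
  mapsTo : Set.MapsTo θ (M : Set (H →L[ℂ] H)) (M : Set (H →L[ℂ] H))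
  unital : θ 1 = 1
  hom : IsStarHomOn (M : Set (H →L[ℂ] H)) θ
  state : ∀ x ∈ M, ⟪θ x Ω, Ω⟫_ℂ = ⟪x Ω, Ω⟫_ℂ

/-- `u` is the isometry of the GNS space implementing `θ`:  `u x Ω = θ(x) Ω`. -/
def Implements (M : VonNeumannAlgebra H) (Ω : H) (θ : (H →L[ℂ] H) → (H →L[ℂ] H))
    (u : H →L[ℂ] H) : Prop :=
  (∀ ξ : H, ‖u ξ‖ = ‖ξ‖) ∧ ∀ x ∈ M, u (x Ω) = θ x Ω

/-- `u` commutes with the modular conjugation `J`. -/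
def CommutesWithJ (J : H → H) (u : H →L[ℂ] H) : Prop := ∀ ξ : H, u (J ξ) = J (u ξ)

/-- `θ` is equi-modular: its implementing isometry commutes with `J`. -/
def EquiModular (M : VonNeumannAlgebra H) (Ω : H) (J : H → H)
    (θ : (H →L[ℂ] H) → (H →L[ℂ] H)) : Prop :=
  ∃ u : H →L[ℂ] H, Implements M Ω θ u ∧ CommutesWithJ J u

/-- `Θ = θ⁽²⁾` is a unital normal `*`-endomorphism of `B(L²(M,φ))` extending `θ` and
`j ∘ θ ∘ j`. -/
structure IsExtension (M : VonNeumannAlgebra H) (j : (H →L[ℂ] H) → (H →L[ℂ] H))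
    (θ : (H →L[ℂ] H) → (H →L[ℂ] H)) (Θ : (H →L[ℂ] H) → (H →L[ℂ] H)) : Prop where
  hom : IsStarHomOn (Set.univ : Set (H →L[ℂ] H)) Θ
  unital : Θ 1 = 1
  normal : IsNormalMapOn (Set.univ : Set (H →L[ℂ] H)) Θ
  onM : ∀ x ∈ M, Θ x = θ x
  onComm : ∀ x ∈ M, Θ (j x) = j (θ x)

/-- `θ` is extendable. -/
def Extendable (M : VonNeumannAlgebra H) (j : (H →L[ℂ] H) → (H →L[ℂ] H))
    (θ : (H →L[ℂ] H) → (H →L[ℂ] H)) : Prop :=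
  ∃ Θ : (H →L[ℂ] H) → (H →L[ℂ] H), IsExtension M j θ Θ

/-- An `E₀`-semigroup on the von Neumann probability space `(M, ⟨·Ω,Ω⟩)`. -/
structure IsE0Semigroup (M : VonNeumannAlgebra H) (Ω : H)
    (α : ℝ → (H →L[ℂ] H) → (H →L[ℂ] H)) : Prop where
  endo : ∀ t : ℝ, 0 ≤ t → StateEndo M Ω (α t)
  id0 : ∀ x ∈ M, α 0 x = x
  semigroup : ∀ s t : ℝ, 0 ≤ s → 0 ≤ t → ∀ x ∈ M, α s (α t x) = α (s + t) x
  weakCont : ∀ x ∈ M, ∀ ξ η : H, ContinuousOn (fun t : ℝ => ⟪α t x ξ, η⟫_ℂ) (Set.Ici 0)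

/-- The linear span of the ranges of the operators in `E`. -/
def rSpan (E : Set (H →L[ℂ] H)) : Submodule ℂ H :=
  Submodule.span ℂ {ξ : H | ∃ w ∈ E, ∃ η : H, w η = ξ}

/-- The projection onto the closed span of the ranges of the operators in `E`. -/
def rProj (E : Set (H →L[ℂ] H)) : H →L[ℂ] H :=
  (rSpan E).topologicalClosure.starProjection

lemma rProj_mul {E : Set (H →L[ℂ] H)} {w : H →L[ℂ] H} (hw : w ∈ E) : rProj E * w = w := by
  ext ξ
  refine Submodule.starProjection_eq_self_iff.mpr ?_
  exact (rSpan E).le_topologicalClosure (Submodule.subset_span ⟨w, hw, ξ, rfl⟩)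

lemma rProj_sa (E : Set (H →L[ℂ] H)) : star (rProj E) = rProj E :=
  (isStarProjection_iff_eq_starProjection.mpr ⟨_, inferInstance, rfl⟩ :
    IsStarProjection (rProj E)).isSelfAdjoint.star_eq

lemma rProj_idem (E : Set (H →L[ℂ] H)) : rProj E * rProj E = rProj E :=
  Submodule.isIdempotentElem_starProjection _

lemma rProj_ext {E : Set (H →L[ℂ] H)} {A B : H →L[ℂ] H} (h : ∀ w ∈ E, A * w = B * w) :
    A * rProj E = B * rProj E := by
  ext ξ
  have hm : rProj E ξ ∈ (rSpan E).topologicalClosure := Submodule.starProjection_apply_mem _ _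
  change A (rProj E ξ) = B (rProj E ξ)
  generalize rProj E ξ = ζ at hm
  have hcl : IsClosed {ζ : H | A ζ = B ζ} := isClosed_eq A.continuous B.continuous
  refine (hcl.closure_subset_iff.mpr ?_) hm
  intro ζ hζ
  induction hζ using Submodule.span_induction with
  | mem x hx =>
    obtain ⟨w, hw, η, rfl⟩ := hx
    exact congrArg (fun S : H →L[ℂ] H => S η) (h w hw)
  | zero => simp
  | add x y _ _ hx hy => simp only [Set.mem_ofPred_eq, map_add] at *; rw [hx, hy]
  | smul c x _ hx => simp only [Set.mem_ofPred_eq, map_smul] at *; rw [hx]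

lemma gram_bound {E : Set (H →L[ℂ] H)}
    (hE : ∀ v ∈ E, ∀ w ∈ E, ∃ c : ℂ, star v * w = c • (1 : H →L[ℂ] H))
    (T : H →L[ℂ] H) (f : E →₀ H) :
    ‖∑ w ∈ f.support, (w : H →L[ℂ] H) (T (f w))‖ ≤
      ‖T‖ * ‖∑ w ∈ f.support, (w : H →L[ℂ] H) (f w)‖ := by
  have hE' : ∀ v w : E, ∃ c : ℂ, star (v : H →L[ℂ] H) * w = c • (1 : H →L[ℂ] H) :=
    fun v w => hE v v.2 w w.2
  choose c hc using hE'
  have key : ∀ S : H →L[ℂ] H, ⟪∑ w ∈ f.support, (w : H →L[ℂ] H) (S (f w)),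
      ∑ w ∈ f.support, (w : H →L[ℂ] H) (S (f w))⟫_ℂ =
      ∑ v ∈ f.support, ∑ w ∈ f.support, c v w * ⟪f v, (star S * S) (f w)⟫_ℂ := by
    intro S
    simp only [sum_inner, inner_sum]
    rw [Finset.sum_comm]
    refine Finset.sum_congr rfl fun v _ => Finset.sum_congr rfl fun w _ => ?_
    rw [← ContinuousLinearMap.adjoint_inner_right, ← ContinuousLinearMap.star_eq_adjoint,
      ← ContinuousLinearMap.mul_apply, hc, ContinuousLinearMap.mul_apply,
      ContinuousLinearMap.star_eq_adjoint S,
      ContinuousLinearMap.adjoint_inner_right]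
    simp [inner_smul_right]
  obtain ⟨R, hR⟩ := CStarAlgebra.nonneg_iff_eq_star_mul_self.mp
    (sub_nonneg.mpr (CStarAlgebra.star_mul_le_algebraMap_norm_sq (a := T)))
  have h1 := key R
  have h2 := key T
  have h3 := key 1
  have h4 : (⟪∑ w ∈ f.support, (w : H →L[ℂ] H) (R (f w)),
      ∑ w ∈ f.support, (w : H →L[ℂ] H) (R (f w))⟫_ℂ) = ((‖T‖ ^ 2 : ℝ) : ℂ) *
      ⟪∑ w ∈ f.support, (w : H →L[ℂ] H) (f w), ∑ w ∈ f.support, (w : H →L[ℂ] H) (f w)⟫_ℂ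
      - ⟪∑ w ∈ f.support, (w : H →L[ℂ] H) (T (f w)),
        ∑ w ∈ f.support, (w : H →L[ℂ] H) (T (f w))⟫_ℂ := by
    rw [h1, h2]
    simp only [ContinuousLinearMap.one_apply] at h3
    rw [h3, Finset.mul_sum, ← Finset.sum_sub_distrib]
    refine Finset.sum_congr rfl fun v _ => ?_
    rw [Finset.mul_sum, ← Finset.sum_sub_distrib]
    refine Finset.sum_congr rfl fun w _ => ?_
    rw [← hR]
    have : (algebraMap ℝ (H →L[ℂ] H) (‖T‖ ^ 2)) (f w) = ((‖T‖ ^ 2 : ℝ) : ℂ) • f w := by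
      rw [Algebra.algebraMap_eq_smul_one]
      simp only [ContinuousLinearMap.smul_apply, ContinuousLinearMap.one_apply]
      exact (Complex.coe_smul _ _).symm
    rw [ContinuousLinearMap.sub_apply, this, inner_sub_right, inner_smul_right]
    simp
    ring
  have h5 := congrArg Complex.re h4
  have e : ∀ a : H, (⟪a, a⟫_ℂ).re = ‖a‖ ^ 2 := fun a => inner_self_eq_norm_sq (𝕜 := ℂ) a
  rw [Complex.sub_re, Complex.re_ofReal_mul, e, e, e] at h5
  have h6 : ‖∑ w ∈ f.support, (w : H →L[ℂ] H) (T (f w))‖ ^ 2 ≤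
      (‖T‖ * ‖∑ w ∈ f.support, (w : H →L[ℂ] H) (f w)‖) ^ 2 := by
    rw [mul_pow]
    nlinarith [sq_nonneg ‖∑ w ∈ f.support, (w : H →L[ℂ] H) (R (f w))‖]
  exact (pow_le_pow_iff_left₀ (norm_nonneg _) (by positivity) two_ne_zero).mp h6

lemma exists_ampl {E : Set (H →L[ℂ] H)}
    (hE : ∀ v ∈ E, ∀ w ∈ E, ∃ c : ℂ, star v * w = c • (1 : H →L[ℂ] H))
    (T : H →L[ℂ] H) :
    ∃ S : H →L[ℂ] H, (∀ w ∈ E, S * w = w * T) ∧ S * rProj E = S := by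
  classical
  let L : (E →₀ H) →ₗ[ℂ] H := Finsupp.lsum ℂ (fun w : E => ((w : H →L[ℂ] H) : H →ₗ[ℂ] H))
  let LT : (E →₀ H) →ₗ[ℂ] H :=
    Finsupp.lsum ℂ (fun w : E => ((w * T : H →L[ℂ] H) : H →ₗ[ℂ] H))
  have hL : ∀ f, L f ∈ (rSpan E).topologicalClosure := by
    intro f
    refine (rSpan E).le_topologicalClosure ?_
    simp only [L, Finsupp.lsum_apply, Finsupp.sum]
    exact Submodule.sum_mem _ fun w _ => Submodule.subset_span ⟨w, w.2, f w, rfl⟩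
  have hr : rSpan E ≤ LinearMap.range L := by
    refine Submodule.span_le.mpr ?_
    rintro _ ⟨w, hw, η, rfl⟩
    exact ⟨Finsupp.single ⟨w, hw⟩ η, by simp [L]⟩
  let e : (E →₀ H) →ₗ[ℂ] (rSpan E).topologicalClosure := L.codRestrict _ hL
  have hd : DenseRange e := by
    intro x
    rw [Topology.IsEmbedding.subtypeVal.closure_eq_preimage_closure_image]
    have hx : (x : H) ∈ closure (rSpan E : Set H) := x.2
    refine closure_mono ?_ hx
    intro y hy
    obtain ⟨f, rfl⟩ := hr hy
    exact ⟨e f, ⟨f, rfl⟩, rfl⟩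
  have hb : ∃ C, ∀ f, ‖LT f‖ ≤ C * ‖e f‖ := by
    refine ⟨‖T‖, fun f => ?_⟩
    exact gram_bound hE T f
  refine ⟨(LT.extendOfNorm e) ∘L (rSpan E).topologicalClosure.orthogonalProjectionOnto, ?_, ?_⟩
  · intro w hw
    ext ξ
    have h1 : (rSpan E).topologicalClosure.orthogonalProjectionOnto (w ξ) =
        e (Finsupp.single ⟨w, hw⟩ ξ) := by
      apply Subtype.ext
      have := congrArg (fun S : H →L[ℂ] H => S ξ) (rProj_mul hw)
      refine Eq.trans this ?_
      simp [e, L]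
    change LT.extendOfNorm e ((rSpan E).topologicalClosure.orthogonalProjectionOnto (w ξ)) = _
    rw [h1, LinearMap.extendOfNorm_eq hd hb]
    simp [LT]
  · ext ξ
    change LT.extendOfNorm e ((rSpan E).topologicalClosure.orthogonalProjectionOnto (rProj E ξ))
      = LT.extendOfNorm e ((rSpan E).topologicalClosure.orthogonalProjectionOnto ξ)
    congr 1
    apply Subtype.ext
    exact congrArg (fun S : H →L[ℂ] H => S ξ) (rProj_idem E)

lemma ampl_left {E : Set (H →L[ℂ] H)} {S T : H →L[ℂ] H}
    (h1 : ∀ w ∈ E, S * w = w * T) (h2 : S * rProj E = S) : rProj E * S = S := by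
  have h := rProj_ext (E := E) (A := rProj E * S) (B := S) (fun w hw => by
    rw [mul_assoc, h1 w hw, ← mul_assoc, rProj_mul hw])
  rwa [mul_assoc, h2] at h

lemma ampl_hom {E : Set (H →L[ℂ] H)}
    (hE : ∀ v ∈ E, ∀ w ∈ E, ∃ c : ℂ, star v * w = c • (1 : H →L[ℂ] H))
    (Θ : (H →L[ℂ] H) → (H →L[ℂ] H)) (h1 : ∀ T, ∀ w ∈ E, Θ T * w = w * T)
    (h2 : ∀ T, Θ T * rProj E = Θ T) : IsStarHomOn (Set.univ : Set (H →L[ℂ] H)) Θ := by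
  have h3 : ∀ T, rProj E * Θ T = Θ T := fun T => ampl_left (h1 T) (h2 T)
  refine ⟨?_, ?_, ?_, ?_⟩
  · intro x _ y _
    have h := rProj_ext (E := E) (A := Θ (x + y)) (B := Θ x + Θ y) (fun w hw => by
      rw [add_mul, h1 _ w hw, h1 _ w hw, h1 _ w hw, mul_add])
    rwa [add_mul, h2, h2, h2] at h
  · intro c x _
    have h := rProj_ext (E := E) (A := Θ (c • x)) (B := c • Θ x) (fun w hw => by
      rw [smul_mul_assoc, h1 _ w hw, h1 _ w hw, mul_smul_comm])
    rwa [smul_mul_assoc, h2, h2] at h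
  · intro x _ y _
    have h := rProj_ext (E := E) (A := Θ (x * y)) (B := Θ x * Θ y) (fun w hw => by
      rw [mul_assoc, h1 (x * y) w hw, h1 y w hw, ← mul_assoc (Θ x), h1 x w hw, mul_assoc])
    rwa [mul_assoc, h2, h2] at h
  · intro T _
    have h4 : rProj E * star (Θ T) = star (Θ T) := by
      have := congrArg star (h2 T)
      rwa [star_mul, rProj_sa] at this
    have h5 : star (Θ T) * rProj E = star (Θ T) := by
      have := congrArg star (h3 T)
      rwa [star_mul, rProj_sa] at this
    have h6 : ∀ w ∈ E, star (Θ T) * w = w * star T := by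
      intro w hw
      have h7 : ∀ v ∈ E, star (star (Θ T) * w - w * star T) * v = 0 * v := by
        intro v hv
        obtain ⟨c, hc⟩ := hE w hw v hv
        simp only [star_sub, star_mul, star_star, sub_mul, zero_mul]
        rw [mul_assoc, h1 T v hv, ← mul_assoc, hc, mul_assoc, hc]
        simp
      have h8 := rProj_ext h7
      have h9 : rProj E * (star (Θ T) * w - w * star T) = star (Θ T) * w - w * star T := by
        rw [mul_sub, ← mul_assoc, h4, ← mul_assoc, rProj_mul hw]
      have h10 := congrArg star h9
      rw [star_mul, rProj_sa, h8, zero_mul] at h10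
      have h11 := congrArg star h10
      rw [star_star, star_zero] at h11
      exact (sub_eq_zero.mp h11.symm)
    have h := rProj_ext (E := E) (A := Θ (star T)) (B := star (Θ T)) (fun w hw => by
      rw [h1 _ w hw, h6 w hw])
    rwa [h2, h5] at h

lemma ampl_normal {E : Set (H →L[ℂ] H)}
    (Θ : (H →L[ℂ] H) → (H →L[ℂ] H)) (h1 : ∀ T, ∀ w ∈ E, Θ T * w = w * T)
    (h2 : ∀ T, Θ T * rProj E = Θ T) (hh : IsStarHomOn (Set.univ : Set (H →L[ℂ] H)) Θ) :
    IsNormalMapOn (Set.univ : Set (H →L[ℂ] H)) Θ := by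
  classical
  intro ι p q _ _ hp ho hs ξ
  let F : Finset ι → H → H := fun s ζ => ∑ i ∈ s, Θ (p i) ζ
  have hz : Θ 0 = 0 := by simpa using hh.map_smul 0 0 trivial
  have hF : ∀ s, LipschitzWith 1 (F s) := by
    intro s
    have hproj : IsStarProjection (∑ i ∈ s, Θ (p i)) := by
      refine ⟨?_, ?_⟩
      · change (∑ i ∈ s, Θ (p i)) * (∑ i ∈ s, Θ (p i)) = _
        rw [Finset.sum_mul_sum]
        refine Finset.sum_congr rfl fun i hi => ?_
        rw [Finset.sum_eq_single i]
        · rw [← hh.map_mul _ trivial _ trivial, (hp i).2]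
        · intro k _ hk
          rw [← hh.map_mul _ trivial _ trivial, ho i k hk.symm, hz]
        · exact fun h => absurd hi h
      · change star _ = _
        rw [star_sum]
        refine Finset.sum_congr rfl fun i _ => ?_
        rw [← hh.map_star _ trivial, (hp i).1.star_eq]
    have h := (∑ i ∈ s, Θ (p i)).lipschitz.weaken
      (K' := 1) (by exact_mod_cast hproj.norm_le)
    have hFs : F s = ⇑(∑ i ∈ s, Θ (p i)) := by
      ext ζ
      simp [F]
    rw [hFs]
    exact h
  have hcl : IsClosed {ζ : H | Filter.Tendsto (fun s => F s ζ) Filter.atTop (nhds (Θ q ζ))} :=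
    (LipschitzWith.uniformEquicontinuous F 1 hF).equicontinuous.isClosed_setOfPred_tendsto
      (Θ q).continuous
  have hm : rProj E ξ ∈ (rSpan E).topologicalClosure := Submodule.starProjection_apply_mem _ _
  have e : ∀ T, Θ T ξ = Θ T (rProj E ξ) := fun T =>
    (congrArg (fun S : H →L[ℂ] H => S ξ) (h2 T)).symm
  simp only [e]
  generalize rProj E ξ = ζ at hm
  refine (hcl.closure_subset_iff.mpr ?_) hm
  intro ζ hζ
  change HasSum (fun i => Θ (p i) ζ) (Θ q ζ)
  induction hζ using Submodule.span_induction with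
  | mem x hx =>
    obtain ⟨w, hw, η, rfl⟩ := hx
    have e : ∀ T, Θ T (w η) = w (T η) := fun T =>
      (congrArg (fun S : H →L[ℂ] H => S η) (h1 T w hw))
    simp only [e]
    exact w.hasSum (hs η)
  | zero => simpa using hasSum_zero
  | add x y _ _ hx hy => simpa using hx.add hy
  | smul c x _ hx => simpa using hx.const_smul c

open InnerProductSpace in
lemma ampl_unique {E : Set (H →L[ℂ] H)} {Ω : H} (hΩ : ‖Ω‖ = 1)
    (Θ : (H →L[ℂ] H) → (H →L[ℂ] H)) (h1 : ∀ T, ∀ w ∈ E, Θ T * w = w * T)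
    (h2 : ∀ T, Θ T * rProj E = Θ T)
    (Θ' : (H →L[ℂ] H) → (H →L[ℂ] H)) (hh : IsStarHomOn (Set.univ : Set (H →L[ℂ] H)) Θ')
    (hn : IsNormalMapOn (Set.univ : Set (H →L[ℂ] H)) Θ')
    (hone : Θ' 1 = rProj E) (hE : ∀ w, (∀ T, Θ' T * w = w * T) → w ∈ E) : Θ' = Θ := by
  classical
  have hz : Θ' 0 = 0 := by simpa using hh.map_smul 0 0 trivial
  let Φ : (H →L[ℂ] H) →⋆ₙₐ[ℂ] (H →L[ℂ] H) :=
    { toFun := Θ'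
      map_smul' := fun c x => hh.map_smul c x trivial
      map_zero' := hz
      map_add' := fun x y => hh.map_add x trivial y trivial
      map_mul' := fun x y => hh.map_mul x trivial y trivial
      map_star' := fun x => hh.map_star x trivial }
  have hbd : ∀ T, ‖Θ' T‖ ≤ ‖T‖ := fun T => NonUnitalStarAlgHom.norm_apply_le Φ T
  have hW : ∀ η : H, ∃ w ∈ E, ∀ ξ, w ξ = Θ' (rankOne ℂ ξ Ω) η := by
    intro η
    let L : H →ₗ[ℂ] H :=
      { toFun := fun ξ => Θ' (rankOne ℂ ξ Ω) η
        map_add' := fun a b => by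
          have : rankOne ℂ (a + b) Ω = rankOne ℂ a Ω + rankOne ℂ b Ω := by simp
          rw [this, hh.map_add _ trivial _ trivial]; rfl
        map_smul' := fun c a => by
          have : rankOne ℂ (c • a) Ω = c • rankOne ℂ a Ω := by simp
          rw [this, hh.map_smul _ _ trivial]; rfl }
    let w : H →L[ℂ] H := L.mkContinuous ‖η‖ (fun ξ => by
      refine ((Θ' (rankOne ℂ ξ Ω)).le_opNorm η).trans ?_
      have := hbd (rankOne ℂ ξ Ω)
      rw [norm_rankOne, hΩ, mul_one] at this
      rw [mul_comm]
      gcongr)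
    have hw : ∀ ξ, w ξ = Θ' (rankOne ℂ ξ Ω) η := fun ξ => rfl
    refine ⟨w, hE w fun T => ?_, hw⟩
    ext ξ
    change Θ' T (w ξ) = w (T ξ)
    rw [hw, hw, ← comp_rankOne]
    exact (congrArg (fun S : H →L[ℂ] H => S η)
      (hh.map_mul T trivial (rankOne ℂ ξ Ω) trivial)).symm
  choose W hWE hWeq using hW
  obtain ⟨s, b, hb⟩ := exists_hilbertBasis ℂ H
  funext T
  ext ζ
  have hsum := hn (fun i : s => rankOne ℂ (b i) (b i)) 1 (fun _ => trivial) trivial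
    (fun i => by
      have h := isStarProjection_rankOne_self (𝕜 := ℂ) (b.orthonormal.1 i)
      exact ⟨h.isSelfAdjoint, h.isIdempotentElem⟩)
    (fun i k hik => by
      have := rankOne_comp_rankOne (𝕜 := ℂ) (b i) (b i) (b k) (b k)
      rw [b.orthonormal.2 hik, zero_smul] at this
      exact this)
    (fun ξ => by
      have := b.hasSum_repr ξ
      simp only [b.repr_apply_apply] at this
      exact this) ζ
  have hterm : ∀ i : s, Θ' (rankOne ℂ (b i) (b i)) ζ =
      W (Θ' (rankOne ℂ Ω (b i)) ζ) (b i) := by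
    intro i
    have h := rankOne_comp_rankOne (𝕜 := ℂ) (b i) Ω Ω (b i)
    rw [inner_self_eq_norm_sq_to_K, hΩ] at h
    simp only [RCLike.ofReal_one, one_pow, one_smul] at h
    rw [hWeq, ← h]
    exact congrArg (fun S : H →L[ℂ] H => S ζ)
      (hh.map_mul (rankOne ℂ (b i) Ω) trivial (rankOne ℂ Ω (b i)) trivial)
  have hT : ∀ i : s, Θ' T (Θ' (rankOne ℂ (b i) (b i)) ζ) =
      Θ T (Θ' (rankOne ℂ (b i) (b i)) ζ) := by
    intro i
    have hw := hWE (Θ' (rankOne ℂ Ω (b i)) ζ)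
    have hw' : Θ' T * W (Θ' (rankOne ℂ Ω (b i)) ζ) = W (Θ' (rankOne ℂ Ω (b i)) ζ) * T := by
      ext ξ
      change Θ' T (W _ ξ) = W _ (T ξ)
      rw [hWeq, hWeq, ← comp_rankOne]
      exact (congrArg (fun S : H →L[ℂ] H => S (Θ' (rankOne ℂ Ω (b i)) ζ))
        (hh.map_mul T trivial (rankOne ℂ ξ Ω) trivial)).symm
    rw [hterm]
    exact congrArg (fun S : H →L[ℂ] H => S (b i)) (hw'.trans (h1 T _ hw).symm)
  have s1 := (Θ' T).hasSum hsum
  have s2 := (Θ T).hasSum hsum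
  simp only [hT] at s1
  have heq := s1.unique s2
  have e1 : Θ' T (Θ' 1 ζ) = Θ' T ζ := by
    have := hh.map_mul T trivial 1 trivial
    rw [mul_one] at this
    exact (congrArg (fun S : H →L[ℂ] H => S ζ) this).symm
  have e2 : Θ T (Θ' 1 ζ) = Θ T ζ := by
    rw [hone]
    exact congrArg (fun S : H →L[ℂ] H => S ζ) (h2 T)
  rw [← e1, heq, e2]

/-- **Theorem 3.4 (3).**  Let `θ` be an equi-modular endomorphism of the factor `M` in standard
form.  Then there exists a unique normal `*`-endomorphism `θ⁽²⁾` of `B(L²(M,φ))` satisfying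
`θ⁽²⁾(x j(y)) = θ(x) j(θ(y)) z` for all `x, y ∈ M`, where
`z = ⋀ {p ∈ (θ(M) ∪ j(θ(M)))″ : ran p ⊇ {θ(x) Ω : x ∈ M}}`. -/
theorem theorem_3_4_part_3
    (M : VonNeumannAlgebra H) (Ω : H) (J : H → H) (j : (H →L[ℂ] H) → (H →L[ℂ] H))
    (hSF : StandardForm M Ω J j) (hM : IsFactorSet (M : Set (H →L[ℂ] H)))
    (θ : (H →L[ℂ] H) → (H →L[ℂ] H)) (hθ : StateEndo M Ω θ)
    (u : H →L[ℂ] H) (hu : Implements M Ω θ u) (hequi : CommutesWithJ J u)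
    -- `z` is the infimum of all projections of `N = (θ(M) ∪ j(θ(M)))″` whose range contains
    -- `{θ(x) Ω : x ∈ M}`:
    (z : H →L[ℂ] H)
    (hzmem : z ∈ vN ((θ '' (M : Set (H →L[ℂ] H))) ∪ (j '' (θ '' (M : Set (H →L[ℂ] H))))))
    (hzproj : IsProjection z)
    (hzrange : Set.range ⇑z =
      ⋂ p ∈ {p : H →L[ℂ] H |
          p ∈ vN ((θ '' (M : Set (H →L[ℂ] H))) ∪ (j '' (θ '' (M : Set (H →L[ℂ] H))))) ∧
          IsProjection p ∧ {ξ : H | ∃ x ∈ M, θ x Ω = ξ} ⊆ Set.range ⇑p},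
        Set.range ⇑p) :
    ∃ Θ : (H →L[ℂ] H) → (H →L[ℂ] H),
      (IsStarHomOn (Set.univ : Set (H →L[ℂ] H)) Θ ∧
        IsNormalMapOn (Set.univ : Set (H →L[ℂ] H)) Θ ∧
        ∀ x ∈ M, ∀ y ∈ M, Θ (x * j y) = θ x * j (θ y) * z) ∧
      ∀ Θ' : (H →L[ℂ] H) → (H →L[ℂ] H),
        (IsStarHomOn (Set.univ : Set (H →L[ℂ] H)) Θ' ∧
          IsNormalMapOn (Set.univ : Set (H →L[ℂ] H)) Θ' ∧
          ∀ x ∈ M, ∀ y ∈ M, Θ' (x * j y) = θ x * j (θ y) * z) →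
        Θ' = Θ := by
  classical
  set S : Set (H →L[ℂ] H) :=
    (θ '' (M : Set (H →L[ℂ] H))) ∪ (j '' (θ '' (M : Set (H →L[ℂ] H)))) with hS
  -- the space of intertwiners
  let E : Set (H →L[ℂ] H) :=
    {w | (∀ x ∈ M, w * x = θ x * w) ∧ ∀ y ∈ M, w * j y = j (θ y) * w}
  have j1 : j 1 = 1 := by
    ext ξ
    rw [hSF.jdef]
    exact hSF.Jinvol ξ
  have jstar : ∀ x, j (star x) = star (j x) := by
    intro x
    ext ξ
    refine ext_inner_right ℂ fun η => ?_
    rw [ContinuousLinearMap.star_eq_adjoint (j x), ContinuousLinearMap.adjoint_inner_left,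
      hSF.jdef, hSF.jdef]
    have h1 := hSF.Jinner (star x (J ξ)) (J η)
    have h2 := hSF.Jinner (J ξ) (x (J η))
    rw [hSF.Jinvol] at h1 h2
    rw [h1, h2, ContinuousLinearMap.star_eq_adjoint, ContinuousLinearMap.adjoint_inner_right]
  have hSmem : ∀ m : H →L[ℂ] H, m ∈ Set.centralizer S ↔
      (∀ x ∈ M, θ x * m = m * θ x) ∧ ∀ x ∈ M, j (θ x) * m = m * j (θ x) := by
    intro m
    constructor
    · intro h
      exact ⟨fun x hx => h _ (Or.inl ⟨x, hx, rfl⟩),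
        fun x hx => h _ (Or.inr ⟨θ x, ⟨x, hx, rfl⟩, rfl⟩)⟩
    · rintro ⟨h1, h2⟩ s (⟨x, hx, rfl⟩ | ⟨_, ⟨x, hx, rfl⟩, rfl⟩)
      · exact h1 x hx
      · exact h2 x hx
  have hstarM : ∀ x ∈ M, star x ∈ M := fun x hx => star_mem hx
  have hEs1 : ∀ v ∈ E, ∀ x ∈ M, x * star v = star v * θ x := by
    intro v hv x hx
    have := congrArg star (hv.1 (star x) (hstarM x hx))
    rwa [star_mul, star_mul, star_star, hθ.hom.map_star x hx, star_star] at this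
  have hEs2 : ∀ v ∈ E, ∀ x ∈ M, j x * star v = star v * j (θ x) := by
    intro v hv x hx
    have := congrArg star (hv.2 (star x) (hstarM x hx))
    rwa [star_mul, star_mul, jstar, star_star, hθ.hom.map_star x hx, jstar, star_star] at this
  have hE : ∀ v ∈ E, ∀ w ∈ E, ∃ c : ℂ, star v * w = c • (1 : H →L[ℂ] H) := by
    intro v hv w hw
    have c1 : ∀ x ∈ M, star v * w * x = x * (star v * w) := by
      intro x hx
      rw [mul_assoc, hw.1 x hx, ← mul_assoc, ← hEs1 v hv x hx, mul_assoc]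
    have c2 : ∀ x ∈ M, star v * w * j x = j x * (star v * w) := by
      intro x hx
      rw [mul_assoc, hw.2 x hx, ← mul_assoc, ← hEs2 v hv x hx, mul_assoc]
    refine hM _ ?_ c1
    rw [← VonNeumannAlgebra.centralizer_centralizer M]
    intro y hy
    obtain ⟨x, hx, rfl⟩ := hSF.jsurj y hy
    exact (c2 x hx).symm
  have hdense : ∀ A B : H →L[ℂ] H, (∀ x ∈ M, A (x Ω) = B (x Ω)) → A = B := by
    intro A B h
    have := Continuous.ext_on hSF.cyclic A.continuous B.continuous (by
      rintro _ ⟨x, hx, rfl⟩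
      exact h x hx)
    exact ContinuousLinearMap.ext fun ξ => congrFun this ξ
  have hu1 : ∀ x ∈ M, u * x = θ x * u := by
    intro x hx
    refine hdense _ _ fun y hy => ?_
    change u (x (y Ω)) = θ x (u (y Ω))
    rw [hu.2 y hy]
    have h := hu.2 (x * y) (mul_mem hx hy)
    rw [hθ.hom.map_mul x hx y hy] at h
    exact h
  have huE : u ∈ E := by
    refine ⟨hu1, fun y hy => ?_⟩
    ext ξ
    change u (j y ξ) = j (θ y) (u ξ)
    rw [hSF.jdef, hSF.jdef, hequi, ← hequi ξ]
    exact congrArg J (congrArg (fun S : H →L[ℂ] H => S (J ξ)) (hu1 y hy))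
  have huu : star u * u = 1 := by
    have := (ContinuousLinearMap.norm_map_iff_adjoint_comp_self u).mp hu.1
    rw [ContinuousLinearMap.star_eq_adjoint]
    exact this
  have hNE : ∀ n ∈ Set.centralizer S, ∀ w ∈ E, n * w ∈ E := by
    intro n hn w hw
    rw [hSmem] at hn
    refine ⟨fun x hx => ?_, fun x hx => ?_⟩
    · rw [mul_assoc, hw.1 x hx, ← mul_assoc, ← hn.1 x hx, mul_assoc]
    · rw [mul_assoc, hw.2 x hx, ← mul_assoc, ← hn.2 x hx, mul_assoc]
  have hEN : ∀ w ∈ E, w * star u ∈ Set.centralizer S := by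
    intro w hw
    rw [hSmem]
    refine ⟨fun x hx => ?_, fun x hx => ?_⟩
    · rw [← mul_assoc, ← hw.1 x hx, mul_assoc, hEs1 u huE x hx, mul_assoc]
    · rw [← mul_assoc, ← hw.2 x hx, mul_assoc, hEs2 u huE x hx, mul_assoc]
  have hNstar : ∀ n ∈ Set.centralizer S, star n ∈ Set.centralizer S := by
    intro n hn
    rw [hSmem] at hn ⊢
    refine ⟨fun x hx => ?_, fun x hx => ?_⟩
    · have := congrArg star (hn.1 (star x) (hstarM x hx))
      rw [hθ.hom.map_star x hx, star_mul, star_mul, star_star] at this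
      exact this.symm
    · have := congrArg star (hn.2 (star x) (hstarM x hx))
      rw [hθ.hom.map_star x hx, jstar, star_mul, star_mul, star_star] at this
      exact this.symm
  -- `z` is the projection onto the closed span of the ranges of the intertwiners
  have hzθ : ∀ x ∈ M, z (θ x Ω) = θ x Ω := by
    intro x hx
    have hmem : θ x Ω ∈ Set.range ⇑z := by
      rw [hzrange]
      refine Set.mem_iInter₂.mpr fun p hp => hp.2.2 ⟨x, hx, rfl⟩
    obtain ⟨ξ, hξ⟩ := hmem
    rw [← hξ]
    exact congrArg (fun S : H →L[ℂ] H => S ξ) hzproj.2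
  have hzu : z * u = u := by
    refine hdense _ _ fun x hx => ?_
    change z (u (x Ω)) = u (x Ω)
    rw [hu.2 x hx, hzθ x hx]
  have hzw : ∀ w ∈ E, z * w = w := by
    intro w hw
    have hw' : w * star u * u = w := by rw [mul_assoc, huu, mul_one]
    have hc : w * star u * z = z * (w * star u) := hzmem _ (hEN w hw)
    calc z * w = z * (w * star u * u) := by rw [hw']
      _ = w * star u * (z * u) := by rw [← mul_assoc, ← hc, mul_assoc]
      _ = w := by rw [hzu, hw']
  have hPmem : rProj E ∈ vN S := by
    have hP : ∀ n ∈ Set.centralizer S, rProj E * n * rProj E = n * rProj E := by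
      intro n hn
      exact rProj_ext fun w hw => by rw [mul_assoc, rProj_mul (hNE n hn w hw)]
    intro n hn
    have h1 := congrArg star (hP _ (hNstar n hn))
    simp only [star_mul, star_star, rProj_sa] at h1
    exact (hP n hn).symm.trans ((mul_assoc _ _ _).trans h1)
  have hPz : rProj E * z = z := by
    ext ξ
    have hmem : z ξ ∈ Set.range ⇑(rProj E) := by
      have h0 : z ξ ∈ Set.range ⇑z := ⟨ξ, rfl⟩
      rw [hzrange] at h0
      refine Set.mem_iInter₂.mp h0 (rProj E) ⟨hPmem, ⟨rProj_sa E, rProj_idem E⟩, ?_⟩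
      rintro _ ⟨x, hx, rfl⟩
      refine ⟨u (x Ω), ?_⟩
      rw [← hu.2 x hx]
      exact congrArg (fun S : H →L[ℂ] H => S (x Ω)) (rProj_mul huE)
    obtain ⟨ζ, hζ⟩ := hmem
    change rProj E (z ξ) = z ξ
    rw [← hζ]
    exact congrArg (fun S : H →L[ℂ] H => S ζ) (rProj_idem E)
  have hzP : z = rProj E := by
    have h1 : z * rProj E = 1 * rProj E := rProj_ext fun w hw => by rw [hzw w hw, one_mul]
    have h2 := congrArg star hPz
    rw [star_mul, rProj_sa, hzproj.1.star_eq, h1, one_mul] at h2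
    exact h2.symm
  choose Θ h1 h2 using exists_ampl hE
  have hhom := ampl_hom hE Θ h1 h2
  refine ⟨Θ, ⟨hhom, ampl_normal Θ h1 h2 hhom, ?_⟩, ?_⟩
  · intro x hx y hy
    rw [← h2, hzP]
    refine rProj_ext fun w hw => ?_
    rw [h1 _ w hw, ← mul_assoc, hw.1 x hx, mul_assoc, hw.2 y hy, mul_assoc]
  · rintro Θ' ⟨hh', hn', hx'⟩
    have hone : (1 : H →L[ℂ] H) ∈ M := one_mem M
    have hΘ1 : Θ' 1 = rProj E := by
      have := hx' 1 hone 1 hone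
      rw [hθ.unital, j1, one_mul, one_mul, hzP] at this
      exact this
    refine ampl_unique hSF.unit Θ h1 h2 Θ' hh' hn' hΘ1 ?_
    intro w hw
    have hPw : z * w = w := by
      have := hw 1
      rwa [hΘ1, ← hzP, mul_one] at this
    refine ⟨fun x hx => ?_, fun y hy => ?_⟩
    · have h := hx' x hx 1 hone
      rw [hθ.unital, j1, mul_one, mul_one] at h
      rw [← hw x, h, mul_assoc, hPw]
    · have h := hx' 1 hone y hy
      rw [hθ.unital, one_mul, one_mul] at h
      rw [← hw (j y), h, mul_assoc, hPw]

end Paper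
end
end

section
/- Let φ be a faithful normal state on a factor M acting standardly on L²(M,φ), let θ be an equi-modular endomorphism of (M,φ), and let P = θ(M) ⊂ M ⊂ P₁ = JP′J be Jones' basic construction. The following conditions are equivalent: (1) there exists a unique unital normal *-endomorphism θ⁽²⁾ of B(L²(M,φ)) such that θ⁽²⁾(x) = θ(x) and θ⁽²⁾(j(x)) = j(θ(x)) for all x ∈ M; (2) P ∨ JPJ is a factor, and in this case it is necessarily of type I; (3) (P ∨ JPJ)′ = P′∩P₁ is a factor, and in this case it is necessarily of type I; (4) the set {x ŷ : x ∈ P′∩P₁, y ∈ P} is total in L²(M,φ), where ŷ = y1̂_M. -/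
set_option synthInstance.maxHeartbeats 400000
set_option maxHeartbeats 1000000

open scoped InnerProductSpace ComplexConjugate

noncomputable section

namespace Paper

variable {H : Type} [NormedAddCommGroup H] [InnerProductSpace ℂ H] [CompleteSpace H]
variable {H' : Type} [NormedAddCommGroup H'] [InnerProductSpace ℂ H'] [CompleteSpace H']

/-- Intertwiners for a set of pairs of operators. -/
def Intw (T : Set ((H →L[ℂ] H) × (H →L[ℂ] H))) (w : H →L[ℂ] H) : Prop :=
  ∀ t ∈ T, w * t.1 = t.2 * w

/-- Ranges of intertwiners. -/
def rngs (S : Set (H →L[ℂ] H)) : Set H := {ξ | ∃ w ∈ S, ∃ η, w η = ξ}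

/-- Standing abstract hypotheses. -/
structure Setup (T : Set ((H →L[ℂ] H) × (H →L[ℂ] H))) (A : Set (H →L[ℂ] H))
    (u : H →L[ℂ] H) : Prop where
  tstar : ∀ t ∈ T, (star t.1, star t.2) ∈ T
  irr : ∀ b : H →L[ℂ] H, (∀ t ∈ T, b * t.1 = t.1 * b) → ∃ c : ℂ, b = c • (1 : H →L[ℂ] H)
  memA : ∀ a, a ∈ A ↔ ∀ t ∈ T, a * t.2 = t.2 * a
  intu : Intw T u
  isou : star u * u = 1

lemma proj_comm (V : Submodule ℂ H) [V.HasOrthogonalProjection] (g : H →L[ℂ] H)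
    (h1 : ∀ v ∈ V, g v ∈ V) (h2 : ∀ v ∈ V, star g v ∈ V) :
    V.starProjection * g = g * V.starProjection := by
  ext ξ
  simp only [mul_apply_eq_comp]
  apply Submodule.eq_starProjection_of_mem_of_inner_eq_zero
  · exact h1 _ (V.starProjection_apply_mem ξ)
  · intro w hw
    rw [← map_sub, ← ContinuousLinearMap.adjoint_inner_right]
    exact V.starProjection_inner_eq_zero ξ _ (h2 w hw)

lemma closure_inv (S : Set H) (g : H →L[ℂ] H) (h : ∀ v ∈ S, g v ∈ S) :
    ∀ v ∈ (Submodule.span ℂ S).topologicalClosure,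
      g v ∈ (Submodule.span ℂ S).topologicalClosure := by
  intro v hv
  have h1 : ∀ v ∈ Submodule.span ℂ S, g v ∈ Submodule.span ℂ S := by
    intro v hv
    have : Submodule.span ℂ S ≤ (Submodule.span ℂ S).comap (g : H →ₗ[ℂ] H) := by
      rw [Submodule.span_le]
      intro s hs
      exact Submodule.subset_span (h s hs)
    exact this hv
  exact map_mem_closure g.continuous hv h1

lemma ext_rngs {S : Set (H →L[ℂ] H)} (hS : Dense (Submodule.span ℂ (rngs S) : Set H))
    {x y : H →L[ℂ] H} (h : ∀ w ∈ S, x * w = y * w) : x = y := by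
  refine ContinuousLinearMap.ext_on hS ?_
  rintro _ ⟨w, hw, η, rfl⟩
  exact DFunLike.congr_fun (h w hw) η

namespace Setup

variable {T : Set ((H →L[ℂ] H) × (H →L[ℂ] H))} {A : Set (H →L[ℂ] H)} {u : H →L[ℂ] H}

lemma adj (h : Setup T A u) {w : H →L[ℂ] H} (hw : Intw T w) {t} (ht : t ∈ T) :
    t.1 * star w = star w * t.2 := by
  have := hw _ (h.tstar t ht)
  simpa using congrArg star this

lemma scal (h : Setup T A u) {w w' : H →L[ℂ] H} (hw : Intw T w) (hw' : Intw T w') :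
    ∃ c : ℂ, star w * w' = c • (1 : H →L[ℂ] H) := by
  apply h.irr
  intro t ht
  rw [mul_assoc, hw' t ht, ← mul_assoc, ← h.adj hw ht, mul_assoc]

lemma amul (h : Setup T A u) {a w : H →L[ℂ] H} (ha : a ∈ A) (hw : Intw T w) : Intw T (a * w) := by
  intro t ht
  rw [mul_assoc, hw t ht, ← mul_assoc, (h.memA a).1 ha t ht, mul_assoc]

lemma memA' (h : Setup T A u) {w w' : H →L[ℂ] H} (hw : Intw T w) (hw' : Intw T w') :
    w * star w' ∈ A := by
  rw [h.memA]
  intro t ht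
  rw [mul_assoc, ← h.adj hw' ht, ← mul_assoc, hw t ht, mul_assoc]

lemma starA (h : Setup T A u) {a : H →L[ℂ] H} (ha : a ∈ A) : star a ∈ A := by
  rw [h.memA] at *
  intro t ht
  have := ha _ (h.tstar t ht)
  simpa using congrArg star this.symm

/-- totality implies factor -/
lemma factor_of_dense (h : Setup T A u)
    (hd : Dense (Submodule.span ℂ (rngs {w | Intw T w}) : Set H)) : IsFactorSet A := by
  intro x hx hc
  obtain ⟨c, hc'⟩ := h.scal h.intu (h.amul hx h.intu)
  have hxu : x * u = c • u := by
    have h1 : u * star u * (x * u) = x * u := by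
      rw [← mul_assoc, ← hc _ (h.memA' h.intu h.intu), mul_assoc, mul_assoc, h.isou, mul_one]
    rw [← h1, mul_assoc, hc']; simp
  refine ⟨c, ext_rngs hd ?_⟩
  intro w hw
  have hw1 : w = (w * star u) * u := by rw [mul_assoc, h.isou, mul_one]
  rw [hw1, ← mul_assoc, hc _ (h.memA' hw h.intu), mul_assoc, hxu]
  simp

lemma dense_of_factor [Nontrivial H] (h : Setup T A u) (hA : IsFactorSet A) :
    Dense (Submodule.span ℂ (rngs {w | Intw T w}) : Set H) := by
  set V := (Submodule.span ℂ (rngs {w | Intw T w})).topologicalClosure with hV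
  have hcomm : ∀ g : H →L[ℂ] H, (∀ v ∈ rngs {w | Intw T w}, g v ∈ rngs {w | Intw T w}) →
      (∀ v ∈ rngs {w | Intw T w}, star g v ∈ rngs {w | Intw T w}) →
      V.starProjection * g = g * V.starProjection := fun g h1 h2 =>
    proj_comm V g (closure_inv _ g h1) (closure_inv _ _ h2)
  have hT : ∀ t ∈ T, ∀ v ∈ rngs {w | Intw T w}, t.2 v ∈ rngs {w | Intw T w} := by
    rintro t ht _ ⟨w, hw, η, rfl⟩
    exact ⟨w, hw, t.1 η, DFunLike.congr_fun (hw t ht) η⟩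
  have hA' : ∀ a ∈ A, ∀ v ∈ rngs {w | Intw T w}, a v ∈ rngs {w | Intw T w} := by
    rintro a ha _ ⟨w, hw, η, rfl⟩
    exact ⟨a * w, h.amul ha hw, η, rfl⟩
  obtain ⟨c, hc⟩ := hA V.starProjection
    ((h.memA _).2 fun t ht => hcomm _ (hT t ht) (hT _ (h.tstar t ht)))
    (fun a ha => hcomm _ (hA' a ha) (hA' _ (h.starA ha)))
  have hVu : ∀ η, u η ∈ V := fun η =>
    Submodule.le_topologicalClosure _ (Submodule.subset_span ⟨u, h.intu, η, rfl⟩)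
  obtain ⟨η, hη⟩ := exists_ne (0 : H)
  have huη : u η ≠ 0 := by
    intro h0
    apply hη
    have := DFunLike.congr_fun h.isou η
    simpa [h0] using this.symm
  have h1 : c • u η = u η := by
    have := Submodule.starProjection_eq_self_iff.2 (hVu η)
    rw [hc] at this; simpa using this
  have hc1 : c = 1 := by
    have : (c - 1) • u η = 0 := by rw [sub_smul, h1]; simp
    rcases smul_eq_zero.1 this with h2 | h2
    · exact sub_eq_zero.1 h2
    · exact absurd h2 huη
  rw [Submodule.dense_iff_topologicalClosure_eq_top, ← hV, eq_top_iff]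
  intro ξ _
  rw [← Submodule.starProjection_eq_self_iff, hc, hc1]; simp

/-- minimality of `u u*` -/
lemma typeI (h : Setup T A u) [Nontrivial H] (hA : IsFactorSet A) : IsTypeIFactorSet A := by
  refine ⟨hA, u * star u, h.memA' h.intu h.intu, ?_, ⟨by simp [IsSelfAdjoint], ?_⟩, ?_⟩
  · intro h0
    have : star u * (u * star u) * u = 0 := by rw [h0]; simp
    rw [← mul_assoc, h.isou, one_mul, h.isou] at this
    exact one_ne_zero this
  · rw [mul_assoc, ← mul_assoc (star u), h.isou, one_mul]
  · intro q hq hqp hqe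
    obtain ⟨c, hc⟩ := h.scal h.intu (h.amul hq h.intu)
    have hq' : (u * star u) * q = q := by
      have := congrArg star hqe
      simpa [hqp.1.star_eq, mul_assoc] using this
    have hqc : q = c • (u * star u) := by
      have : q = u * (star u * (q * u)) * star u := by
        conv_lhs => rw [← hq', ← hqe]
        simp only [mul_assoc]
      rw [this, hc]; simp
    have he : u * star u ≠ 0 := by
      intro h0
      have : star u * (u * star u) * u = 0 := by rw [h0]; simp
      rw [← mul_assoc, h.isou, one_mul, h.isou] at this
      exact one_ne_zero this
    have h2 : (c * c - c) • (u * star u) = 0 := by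
      have h3 := hqp.2
      have h4 : (u * star u) * (u * star u) = u * star u := by
        rw [mul_assoc, ← mul_assoc (star u), h.isou, one_mul]
      rw [hqc] at h3
      rw [smul_mul_smul_comm, h4] at h3
      rw [sub_smul, h3, sub_self]
    rcases smul_eq_zero.1 h2 with h5 | h5
    · have h6 : c * (c - 1) = 0 := by linear_combination h5
      rcases mul_eq_zero.1 h6 with h7 | h7
      · left; rw [hqc, h7, zero_smul]
      · right; rw [hqc, sub_eq_zero.1 h7, one_smul]
    · exact absurd h5 he

end Setup

/-- Orthonormal systems of intertwiners. -/
structure IsONS (T : Set ((H →L[ℂ] H) × (H →L[ℂ] H))) (S : Set (H →L[ℂ] H)) : Prop where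
  int : ∀ w ∈ S, Intw T w
  iso : ∀ w ∈ S, star w * w = 1
  orth : ∀ w ∈ S, ∀ w' ∈ S, w ≠ w' → star w * w' = 0

/-- Abstract extension property. -/
structure AbsExt (T : Set ((H →L[ℂ] H) × (H →L[ℂ] H)))
    (Θ : (H →L[ℂ] H) → (H →L[ℂ] H)) : Prop where
  hom : IsStarHomOn (Set.univ : Set (H →L[ℂ] H)) Θ
  unital : Θ 1 = 1
  normal : IsNormalMapOn (Set.univ : Set (H →L[ℂ] H)) Θ
  on : ∀ t ∈ T, Θ t.1 = t.2

namespace Setup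

variable {T : Set ((H →L[ℂ] H) × (H →L[ℂ] H))} {A : Set (H →L[ℂ] H)} {u : H →L[ℂ] H}

lemma exists_ons (h : Setup T A u) [Nontrivial H]
    (hd : Dense (Submodule.span ℂ (rngs {w | Intw T w}) : Set H)) :
    ∃ S, IsONS T S ∧ Dense (Submodule.span ℂ (rngs S) : Set H) := by
  obtain ⟨S, hS⟩ := zorn_subset {S | IsONS T S} (by
    intro c hc hch
    refine ⟨⋃₀ c, ⟨?_, ?_, ?_⟩, fun s hs => Set.subset_sUnion_of_mem hs⟩
    · rintro w ⟨s, hs, hw⟩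
      exact (hc hs).int w hw
    · rintro w ⟨s, hs, hw⟩
      exact (hc hs).iso w hw
    · rintro w ⟨s, hs, hw⟩ w' ⟨s', hs', hw'⟩ hne
      rcases hch.total hs hs' with h1 | h1
      · exact (hc hs').orth w (h1 hw) w' hw' hne
      · exact (hc hs).orth w hw w' (h1 hw') hne)
  have hS1 : IsONS T S := hS.1
  refine ⟨S, hS1, ?_⟩
  by_contra hnd
  set V := (Submodule.span ℂ (rngs S)).topologicalClosure with hV
  have hinv : ∀ t ∈ T, ∀ v ∈ rngs S, t.2 v ∈ rngs S := by
    rintro t ht _ ⟨w, hw, η, rfl⟩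
    exact ⟨w, hw, t.1 η, DFunLike.congr_fun (hS1.int w hw t ht) η⟩
  have hQ : (1 - V.starProjection) ∈ A := by
    rw [h.memA]
    intro t ht
    have := proj_comm V t.2 (closure_inv _ _ (hinv t ht)) (closure_inv _ _ (hinv _ (h.tstar t ht)))
    rw [sub_mul, mul_sub, this]; simp
  have hPw : ∀ w ∈ S, V.starProjection * w = w := by
    intro w hw
    ext η
    exact Submodule.starProjection_eq_self_iff.2
      (Submodule.le_topologicalClosure _ (Submodule.subset_span ⟨w, hw, η, rfl⟩))
  have hPsa : star V.starProjection = V.starProjection := isSelfAdjoint_starProjection V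
  have hwP : ∀ w ∈ S, star w * (1 - V.starProjection) = 0 := by
    intro w hw
    have := congrArg star (hPw w hw)
    rw [star_mul, hPsa] at this
    rw [mul_sub, this]; simp
  have hex : ∃ w, Intw T w ∧ (1 - V.starProjection) * w ≠ 0 := by
    by_contra! hcon
    apply hnd
    have h1 : (1 - V.starProjection) = 0 := ext_rngs hd fun w hw => by simpa using hcon w hw
    rw [Submodule.dense_iff_topologicalClosure_eq_top, ← hV, eq_top_iff]
    intro ξ _
    rw [← Submodule.starProjection_eq_self_iff]
    have := DFunLike.congr_fun h1 ξ
    simp only [sub_apply, zero_apply] at this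
    exact (sub_eq_zero.1 this).symm
  obtain ⟨w, hw, hne⟩ := hex
  set v := (1 - V.starProjection) * w with hv
  have hvI : Intw T v := h.amul hQ hw
  obtain ⟨c, hc⟩ := h.scal hvI hvI
  have hnorm : ∀ ξ, (‖v ξ‖ ^ 2 : ℂ) = c * (‖ξ‖ ^ 2 : ℂ) := by
    intro ξ
    have h1 := DFunLike.congr_fun hc ξ
    have h2 : ⟪ξ, (star v * v) ξ⟫_ℂ = ⟪v ξ, v ξ⟫_ℂ :=
      ContinuousLinearMap.adjoint_inner_right v ξ (v ξ)
    rw [h1] at h2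
    simp only [smul_apply, inner_smul_right] at h2
    have h3 : ⟪ξ, (1 : H →L[ℂ] H) ξ⟫_ℂ = (‖ξ‖ ^ 2 : ℂ) := inner_self_eq_norm_sq_to_K ξ
    rw [h3] at h2
    rw [h2]
    exact (inner_self_eq_norm_sq_to_K (v ξ)).symm
  obtain ⟨η, hη⟩ : ∃ η, v η ≠ 0 := by
    by_contra! hcon
    exact hne (ContinuousLinearMap.ext hcon)
  have hη0 : η ≠ 0 := by rintro rfl; simp at hη
  set r : ℝ := ‖v η‖ / ‖η‖ with hr
  have hr0 : 0 < r := div_pos (norm_pos_iff.2 hη) (norm_pos_iff.2 hη0)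
  have hcr : c = (r : ℂ) ^ 2 := by
    have := hnorm η
    have h5 : (‖η‖ : ℂ) ≠ 0 := by exact_mod_cast (norm_pos_iff.2 hη0).ne'
    rw [hr]; push_cast
    field_simp
    rw [this]
  have hrC : (r : ℂ) ≠ 0 := by exact_mod_cast hr0.ne'
  set z : H →L[ℂ] H := ((r : ℂ)⁻¹) • v with hz
  have hzz : star z * z = 1 := by
    rw [hz, star_smul, smul_mul_smul_comm, hc, smul_smul, hcr]
    simp only [star_inv₀, Complex.star_def, Complex.conj_ofReal]
    have : (r : ℂ)⁻¹ * (r : ℂ)⁻¹ * (r : ℂ) ^ 2 = 1 := by field_simp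
    rw [this, one_smul]
  have hzI : Intw T z := by
    intro t ht
    rw [hz, smul_mul_assoc, hvI t ht, mul_smul_comm]
  have hwz : ∀ w' ∈ S, star w' * z = 0 := by
    intro w' hw'
    rw [hz, mul_smul_comm, hv, ← mul_assoc, hwP w' hw']; simp
  have hins : IsONS T (insert z S) := by
    refine ⟨?_, ?_, ?_⟩
    · rintro x (rfl | hx)
      · exact hzI
      · exact hS1.int x hx
    · rintro x (rfl | hx)
      · exact hzz
      · exact hS1.iso x hx
    · rintro x (rfl | hx) y (rfl | hy) hxy
      · exact absurd rfl hxy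
      · have := congrArg star (hwz y hy)
        simpa using this
      · exact hwz x hx
      · exact hS1.orth x hx y hy hxy
  have hzS : z ∈ S := hS.2 hins (Set.subset_insert z S) (Set.mem_insert z S)
  have := hwz z hzS
  rw [hzz] at this
  exact one_ne_zero this

lemma exists_op {S : Set (H →L[ℂ] H)} (hS : IsONS T S)
    (hd : Dense (Submodule.span ℂ (rngs S) : Set H)) (x : H →L[ℂ] H) :
    ∃ y : H →L[ℂ] H, ‖y‖ ≤ ‖x‖ ∧ ∀ w ∈ S, y * w = w * x := by
  classical
  let V : S → H →ₗᵢ[ℂ] H := fun w => ⟨(w.1 : H →ₗ[ℂ] H), fun ξ => by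
    have h1 := DFunLike.congr_fun (hS.iso w.1 w.2) ξ
    have h2 : ⟪ξ, (star w.1 * w.1) ξ⟫_ℂ = ⟪w.1 ξ, w.1 ξ⟫_ℂ :=
      ContinuousLinearMap.adjoint_inner_right w.1 ξ (w.1 ξ)
    rw [h1] at h2
    have h3 : ⟪ξ, ξ⟫_ℂ = ⟪w.1 ξ, w.1 ξ⟫_ℂ := h2
    rw [inner_self_eq_norm_sq_to_K, inner_self_eq_norm_sq_to_K] at h3
    have h4 : ‖ξ‖ ^ 2 = ‖w.1 ξ‖ ^ 2 := by exact_mod_cast h3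
    exact ((sq_eq_sq₀ (norm_nonneg _) (norm_nonneg _)).1 h4).symm⟩
  have hV : OrthogonalFamily ℂ (fun _ : S => H) V := by
    intro w w' hne ξ η
    have h1 := DFunLike.congr_fun (hS.orth w.1 w.2 w'.1 w'.2 (fun h => hne (Subtype.ext h))) η
    have h2 : ⟪ξ, (star w.1 * w'.1) η⟫_ℂ = ⟪w.1 ξ, w'.1 η⟫_ℂ :=
      ContinuousLinearMap.adjoint_inner_right w.1 ξ (w'.1 η)
    rw [h1, zero_apply, inner_zero_right] at h2
    exact h2.symm
  have hsum : IsHilbertSum ℂ (fun _ : S => H) V := by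
    refine IsHilbertSum.mk hV ?_
    rw [← Submodule.dense_iff_topologicalClosure_eq_top.1 hd]
    apply Submodule.topologicalClosure_mono
    rw [Submodule.span_le]
    rintro _ ⟨w, hw, η, rfl⟩
    exact Submodule.mem_iSup_of_mem ⟨w, hw⟩ ⟨η, rfl⟩
  let U := hsum.linearIsometryEquiv
  let D : lp (fun _ : S => H) 2 →L[ℂ] lp (fun _ : S => H) 2 :=
    lp.mapCLM 2 (fun _ => x) (norm_nonneg x) (fun _ => le_rfl)
  refine ⟨(U.symm.toContinuousLinearEquiv : _ →L[ℂ] H) ∘L D ∘L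
    (U.toContinuousLinearEquiv : H →L[ℂ] _), ?_, ?_⟩
  · refine ContinuousLinearMap.opNorm_le_bound _ (norm_nonneg x) fun ξ => ?_
    have h1 : ‖U.symm (D (U ξ))‖ ≤ ‖x‖ * ‖ξ‖ := by
      rw [U.symm.norm_map, ← U.norm_map ξ]
      exact D.le_of_opNorm_le (lp.norm_mapCLM_le 2 _ _ _) _
    exact h1
  · intro w hw
    ext η
    show U.symm (D (U (w η))) = w (x η)
    have h1 : ∀ η, U.symm (lp.single 2 (⟨w, hw⟩ : S) η) = w η := fun η =>
      hsum.linearIsometryEquiv_symm_apply_single η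
    rw [← h1 η, U.apply_symm_apply, ← h1 (x η)]
    congr 1
    ext i
    simp only [D, lp.mapCLM_apply_coe]
    by_cases hi : i = ⟨w, hw⟩
    · subst hi; simp
    · simp [lp.single_apply, hi]

end Setup

open InnerProductSpace in
/-- The star homomorphism bundled. -/
def IsStarHomOn.bundle {Θ : (H →L[ℂ] H) → (H →L[ℂ] H)} (h : IsStarHomOn Set.univ Θ) :
    (H →L[ℂ] H) →⋆ₙₐ[ℂ] (H →L[ℂ] H) where
  toFun := Θ
  map_smul' c x := h.map_smul c x trivial
  map_zero' := by simpa using h.map_smul 0 0 trivial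
  map_add' x y := h.map_add x trivial y trivial
  map_mul' x y := h.map_mul x trivial y trivial
  map_star' x := h.map_star x trivial

lemma IsStarHomOn.norm_le {Θ : (H →L[ℂ] H) → (H →L[ℂ] H)} (h : IsStarHomOn Set.univ Θ)
    (x : H →L[ℂ] H) : ‖Θ x‖ ≤ ‖x‖ :=
  NonUnitalStarAlgHom.norm_apply_le h.bundle x

lemma ext_rngs' {S : Set (H →L[ℂ] H)} (hS : Dense (Submodule.span ℂ (rngs S) : Set H))
    {x y : H →L[ℂ] H} (h : ∀ w ∈ S, star w * x = star w * y) : x = y := by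
  apply star_injective
  refine ext_rngs hS fun w hw => ?_
  simpa using congrArg star (h w hw)

lemma proj_norm_le {p : H →L[ℂ] H} (hp : IsProjection p) : ‖p‖ ≤ 1 := by
  have h1 : ‖star p * p‖ = ‖p‖ * ‖p‖ := CStarRing.norm_star_mul_self
  rw [hp.1.star_eq, hp.2] at h1
  by_contra! hcon
  nlinarith

lemma proj_sum {ι : Type} (p : ι → (H →L[ℂ] H)) (hp : ∀ i, IsProjection (p i))
    (ho : ∀ i k, i ≠ k → p i * p k = 0) (F : Finset ι) : IsProjection (∑ i ∈ F, p i) := by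
  classical
  constructor
  · rw [IsSelfAdjoint, star_sum]
    exact Finset.sum_congr rfl fun i _ => (hp i).1.star_eq
  · rw [Finset.sum_mul_sum]
    refine Finset.sum_congr rfl fun i hi => ?_
    rw [Finset.sum_eq_single i (fun k _ hk => ho i k hk.symm) (fun h => absurd hi h)]
    exact (hp i).2

open InnerProductSpace in
/-- A normal endomorphism has many intertwiners. -/
lemma dense_intertwiners [Nontrivial H] {Θ : (H →L[ℂ] H) → (H →L[ℂ] H)}
    (h : IsStarHomOn Set.univ Θ) (h1 : Θ 1 = 1) (hn : IsNormalMapOn Set.univ Θ) :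
    Dense (Submodule.span ℂ (rngs {w : H →L[ℂ] H | ∀ x, Θ x * w = w * x}) : Set H) := by
  obtain ⟨e, he⟩ := exists_norm_eq H zero_le_one
  have hmul : ∀ x y, Θ (x * y) = Θ x * Θ y := fun x y => h.map_mul x trivial y trivial
  let w : H → H →L[ℂ] H := fun ζ => LinearMap.mkContinuous
    { toFun := fun ξ => Θ (rankOne ℂ ξ e) ζ
      map_add' := fun ξ η => by
        rw [map_add, add_apply, h.map_add _ trivial _ trivial, add_apply]
      map_smul' := fun c ξ => by
        rw [map_smul, smul_apply, h.map_smul _ _ trivial, smul_apply]; rfl } ‖ζ‖ (fun ξ => by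
          have h2 := h.norm_le (rankOne ℂ ξ e)
          rw [norm_rankOne, he, mul_one] at h2
          have h3 := (Θ (rankOne ℂ ξ e)).le_of_opNorm_le h2 ζ
          rw [mul_comm]; exact h3)
  have hw : ∀ ζ ξ, w ζ ξ = Θ (rankOne ℂ ξ e) ζ := fun ζ ξ => rfl
  have hwI : ∀ ζ x, Θ x * w ζ = w ζ * x := by
    intro ζ x
    ext ξ
    show Θ x (w ζ ξ) = w ζ (x ξ)
    rw [hw, hw]
    have : rankOne ℂ (x ξ) e = x * rankOne ℂ ξ e := by
      ext η; simp
    rw [this, hmul]; rfl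
  obtain ⟨s, b, hb⟩ := exists_hilbertBasis ℂ H
  intro ξ
  have hon := b.orthonormal
  have key := hn (fun i : s => rankOne ℂ (b i) (b i)) 1 (fun _ => trivial) trivial (fun i => by
      refine ⟨?_, ?_⟩
      · rw [IsSelfAdjoint]
        exact adjoint_rankOne _ _
      · exact isIdempotentElem_rankOne_self (hon.1 i)) (fun i k hik => by
      ext η
      simp [hon.2 hik]) (fun η => by
      have := b.hasSum_repr η
      simpa [b.repr_apply_apply] using this) ξ
  rw [h1] at key
  refine mem_closure_of_tendsto key (Filter.Eventually.of_forall fun F => ?_)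
  refine Submodule.sum_mem _ fun i _ => Submodule.subset_span ?_
  refine ⟨w (Θ (rankOne ℂ e (b i)) ξ), hwI _, b i, ?_⟩
  rw [hw]
  have : rankOne ℂ (b i) (b i) = rankOne ℂ (b i) e * rankOne ℂ e (b i) := by
    ext η
    simp [he]
  rw [this, hmul]; rfl

namespace Setup

variable {T : Set ((H →L[ℂ] H) × (H →L[ℂ] H))} {A : Set (H →L[ℂ] H)} {u : H →L[ℂ] H}

lemma dense_of_ext [Nontrivial H] {Θ : (H →L[ℂ] H) → (H →L[ℂ] H)}
    (hΘ : AbsExt T Θ) : Dense (Submodule.span ℂ (rngs {w | Intw T w}) : Set H) := by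
  refine (dense_intertwiners hΘ.hom hΘ.unital hΘ.normal).mono ?_
  apply Submodule.span_mono
  rintro _ ⟨w, hw, η, rfl⟩
  refine ⟨w, fun t ht => ?_, η, rfl⟩
  rw [← hw, hΘ.on t ht]

lemma ext_apply [Nontrivial H] (h : Setup T A u) {Θ : (H →L[ℂ] H) → (H →L[ℂ] H)}
    (hΘ : AbsExt T Θ) {w : H →L[ℂ] H} (hw : Intw T w) (x : H →L[ℂ] H) :
    Θ x * w = w * x := by
  refine ext_rngs' (dense_intertwiners hΘ.hom hΘ.unital hΘ.normal) fun w' hw' => ?_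
  have hI : Intw T w' := fun t ht => by rw [← hw', hΘ.on t ht]
  obtain ⟨c, hc⟩ := h.scal hI hw
  have h1 : star w' * Θ x = x * star w' := by
    have := congrArg star (hw' (star x))
    rw [hΘ.hom.map_star x trivial] at this
    simpa using this
  rw [← mul_assoc, h1, mul_assoc, hc, ← mul_assoc, hc]
  simp

lemma ext_unique [Nontrivial H] (h : Setup T A u) {Θ Θ' : (H →L[ℂ] H) → (H →L[ℂ] H)}
    (hΘ : AbsExt T Θ) (hΘ' : AbsExt T Θ') : Θ = Θ' := by
  funext x
  refine ext_rngs (dense_of_ext hΘ) fun w hw => ?_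
  rw [h.ext_apply hΘ hw, h.ext_apply hΘ' hw]

lemma exists_ext [Nontrivial H] (h : Setup T A u)
    (hd : Dense (Submodule.span ℂ (rngs {w | Intw T w}) : Set H)) : ∃ Θ, AbsExt T Θ := by
  obtain ⟨S, hS, hSd⟩ := h.exists_ons hd
  choose Θ hΘn hΘ using exists_op hS hSd
  have hhom : IsStarHomOn Set.univ Θ := by
    refine ⟨fun x _ y _ => ?_, fun c x _ => ?_, fun x _ y _ => ?_, fun x _ => ?_⟩
    · refine ext_rngs hSd fun w hw => ?_
      rw [hΘ _ w hw, add_mul, hΘ _ w hw, hΘ _ w hw, mul_add]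
    · refine ext_rngs hSd fun w hw => ?_
      rw [hΘ _ w hw, smul_mul_assoc, hΘ _ w hw, mul_smul_comm]
    · refine ext_rngs hSd fun w hw => ?_
      rw [hΘ _ w hw, mul_assoc, hΘ _ w hw, ← mul_assoc (Θ x), hΘ _ w hw, mul_assoc]
    · refine ext_rngs hSd fun w hw => ?_
      refine ext_rngs' hSd fun w' hw' => ?_
      rw [hΘ _ w hw, ← mul_assoc, ← mul_assoc, ← star_mul, hΘ _ w' hw', star_mul,
        mul_assoc (star x)]
      by_cases hww : w' = w
      · subst hww; rw [hS.iso _ hw]; simp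
      · rw [hS.orth _ hw' _ hw hww]; simp
  have hunital : Θ 1 = 1 := by
    refine ext_rngs hSd fun w hw => ?_
    rw [hΘ _ w hw]; simp
  refine ⟨Θ, hhom, hunital, ?_, ?_⟩
  · intro ι p q _ _ hp ho hsum ξ
    have hadd : ∀ F : Finset ι, ∑ i ∈ F, Θ (p i) ξ - Θ q ξ = Θ (∑ i ∈ F, p i - q) ξ := by
      intro F
      have h1 : Θ (∑ i ∈ F, p i - q) = ∑ i ∈ F, Θ (p i) - Θ q := by
        have := map_sub hhom.bundle (∑ i ∈ F, p i) q
        rw [map_sum] at this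
        exact this
      rw [h1, sub_apply, sum_apply]
    set C : ℝ := 1 + ‖q‖ with hC
    have hC0 : 0 < C := by positivity
    have hbd : ∀ F : Finset ι, ‖Θ (∑ i ∈ F, p i - q)‖ ≤ C := fun F =>
      (hΘn _).trans ((norm_sub_le _ _).trans (by
        have := proj_norm_le (proj_sum p hp ho F)
        linarith))
    have hspan : ∀ η ∈ Submodule.span ℂ (rngs S),
        Filter.Tendsto (fun F : Finset ι => Θ (∑ i ∈ F, p i - q) η) Filter.atTop (nhds 0) := by
      intro η hη
      induction hη using Submodule.span_induction with
      | mem x hx =>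
        obtain ⟨w, hw, η, rfl⟩ := hx
        have h1 : ∀ F : Finset ι, Θ (∑ i ∈ F, p i - q) (w η) = w (∑ i ∈ F, p i η - q η) := by
          intro F
          have := DFunLike.congr_fun (hΘ (∑ i ∈ F, p i - q) w hw) η
          simpa [sum_apply] using this
        simp_rw [h1]
        have h2 : Filter.Tendsto (fun F : Finset ι => ∑ i ∈ F, p i η - q η) Filter.atTop
            (nhds 0) := by
          have := (hsum η : Filter.Tendsto _ _ _).sub_const (q η)
          simpa using this
        have := (w.continuous.tendsto 0).comp h2
        rw [map_zero] at this
        exact this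
      | zero => simp
      | add x y _ _ hx hy => simpa using hx.add hy
      | smul c x _ hx => simpa using hx.const_smul c
    rw [HasSum, SummationFilter.unconditional_filter, tendsto_iff_norm_sub_tendsto_zero]
    simp_rw [hadd]
    rw [Metric.tendsto_nhds]
    intro ε hε
    obtain ⟨η, hη, hηs⟩ := Metric.dense_iff.1 hSd ξ (ε / (2 * C)) (by positivity)
    have h3 := (Metric.tendsto_nhds.1 (hspan η hηs)) (ε / 2) (by positivity)
    filter_upwards [h3] with F hF
    rw [dist_zero_right] at hF
    rw [dist_zero_right, norm_norm]
    have hdist : ‖ξ - η‖ < ε / (2 * C) := by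
      rw [← dist_eq_norm, dist_comm]; exact hη
    have h4 : ‖Θ (∑ i ∈ F, p i - q) (ξ - η)‖ ≤ C * ‖ξ - η‖ :=
      ContinuousLinearMap.le_of_opNorm_le _ (hbd F) _
    have h5 : C * ‖ξ - η‖ < ε / 2 := by
      calc C * ‖ξ - η‖ < C * (ε / (2 * C)) := by gcongr
        _ = ε / 2 := by field_simp
    have h6 : Θ (∑ i ∈ F, p i - q) ξ
        = Θ (∑ i ∈ F, p i - q) (ξ - η) + Θ (∑ i ∈ F, p i - q) η := by
      rw [map_sub]; abel
    rw [h6]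
    exact (norm_add_le _ _).trans_lt (by linarith)
  · intro t ht
    refine ext_rngs hSd fun w hw => ?_
    rw [hΘ _ w hw, hS.int w hw t ht]

/-- The generated algebra is of type I. -/
lemma typeI' [Nontrivial H] (h : Setup T A u) {Θ : (H →L[ℂ] H) → (H →L[ℂ] H)}
    (hΘ : AbsExt T Θ) (hN : IsFactorSet (Set.centralizer A)) :
    IsTypeIFactorSet (Set.centralizer A) := by
  obtain ⟨e, he⟩ := exists_norm_eq H zero_le_one
  have hd := dense_of_ext hΘ
  have hmul : ∀ x y, Θ (x * y) = Θ x * Θ y := fun x y => hΘ.hom.map_mul x trivial y trivial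
  set p := InnerProductSpace.rankOne ℂ e e with hp
  have hpp : p * p = p := InnerProductSpace.isIdempotentElem_rankOne_self he
  have hps : star p = p := InnerProductSpace.adjoint_rankOne _ _
  have hp0 : p ≠ 0 := by
    intro h0
    have := norm_zero (E := H →L[ℂ] H)
    rw [← h0, hp, InnerProductSpace.norm_rankOne, he] at this
    norm_num at this
  refine ⟨hN, Θ p, ?_, ?_, ⟨?_, ?_⟩, ?_⟩
  · intro a ha
    refine ext_rngs hd fun w hw => ?_
    rw [mul_assoc, h.ext_apply hΘ hw, mul_assoc, h.ext_apply hΘ (h.amul ha hw), mul_assoc]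
  · intro h0
    have h1 := h.ext_apply hΘ h.intu p
    rw [h0, zero_mul] at h1
    have h2 : star u * (u * p) = 0 := by rw [← h1]; simp
    rw [← mul_assoc, h.isou, one_mul] at h2
    exact hp0 h2
  · rw [IsSelfAdjoint, ← hΘ.hom.map_star p trivial, hps]
  · rw [← hmul, hpp]
  · intro q hq hqp hqe
    set r := star u * (q * u) with hr
    have hqu : q * u = u * r := by
      have h1 := hq _ (h.memA' h.intu h.intu)
      have h2 : u * star u * q * u = q * (u * star u) * u := by rw [h1]
      rw [mul_assoc q, mul_assoc u (star u) u, h.isou, mul_one] at h2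
      rw [hr]
      conv_lhs => rw [← h2]
      simp only [mul_assoc]
    have hrs : star r = r := by
      rw [hr, star_mul, star_mul, hqp.1.star_eq, star_star, mul_assoc]
    have hrr : r * r = r := by
      have h1 : star u * (q * q * u) = r := by rw [hqp.2]
      rw [mul_assoc, hqu, ← mul_assoc q, hqu, mul_assoc, ← mul_assoc (star u), h.isou,
        one_mul] at h1
      exact h1
    have hrp : r * p = r := by
      have h1 : q * Θ p * u = q * u := by rw [hqe]
      rw [mul_assoc, h.ext_apply hΘ h.intu, ← mul_assoc, hqu] at h1
      have h2 : star u * (u * r * p) = star u * (u * r) := by rw [h1]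
      rwa [mul_assoc u, ← mul_assoc (star u), ← mul_assoc (star u), h.isou, one_mul,
        one_mul] at h2
    have hpr : p * r = r := by
      have := congrArg star hrp
      simpa [hrs, hps] using this
    have hrc : r = ⟪e, r e⟫_ℂ • p := by
      have h1 : p * (r * p) = r := by rw [hrp, hpr]
      conv_lhs => rw [← h1]
      ext η
      simp [hp, smul_smul, mul_comm]
    set c := ⟪e, r e⟫_ℂ with hc
    have hc2 : (c * c - c) • p = 0 := by
      have h3 := hrr
      rw [hrc, smul_mul_smul_comm, hpp] at h3
      rw [sub_smul, h3, sub_self]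
    have hfin : ∀ w, Intw T w → q * w = w * r := by
      intro w hw
      have hw1 : w = (w * star u) * u := by rw [mul_assoc, h.isou, mul_one]
      have h1 := hq _ (h.memA' hw h.intu)
      conv_lhs => rw [hw1, ← mul_assoc, ← h1, mul_assoc, hqu, ← mul_assoc, ← hw1]
    rcases smul_eq_zero.1 hc2 with h5 | h5
    · have h6 : c * (c - 1) = 0 := by linear_combination h5
      rcases mul_eq_zero.1 h6 with h7 | h7
      · left
        rw [h7, zero_smul] at hrc
        refine ext_rngs hd fun w hw => ?_
        rw [hfin w hw, hrc]; simp
      · right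
        rw [sub_eq_zero.1 h7, one_smul] at hrc
        refine ext_rngs hd fun w hw => ?_
        rw [hfin w hw, hrc, h.ext_apply hΘ hw]
    · exact absurd h5 hp0

end Setup

/-- The pairs defining the extension problem. -/
def pairs (M : VonNeumannAlgebra H) (j : (H →L[ℂ] H) → (H →L[ℂ] H))
    (θ : (H →L[ℂ] H) → (H →L[ℂ] H)) : Set ((H →L[ℂ] H) × (H →L[ℂ] H)) :=
  {t | ∃ x ∈ M, t = (x, θ x) ∨ t = (j x, j (θ x))}

lemma ext_iff {M : VonNeumannAlgebra H} {j : (H →L[ℂ] H) → (H →L[ℂ] H)}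
    {θ : (H →L[ℂ] H) → (H →L[ℂ] H)} (Θ : (H →L[ℂ] H) → (H →L[ℂ] H)) :
    IsExtension M j θ Θ ↔ AbsExt (pairs M j θ) Θ := by
  constructor
  · intro h
    refine ⟨h.hom, h.unital, h.normal, ?_⟩
    rintro _ ⟨x, hx, rfl | rfl⟩
    · exact h.onM x hx
    · exact h.onComm x hx
  · intro h
    exact ⟨h.hom, h.unital, h.normal, fun x hx => h.on (x, θ x) ⟨x, hx, Or.inl rfl⟩,
      fun x hx => h.on (j x, j (θ x)) ⟨x, hx, Or.inr rfl⟩⟩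

lemma memA_iff {M : VonNeumannAlgebra H} {j : (H →L[ℂ] H) → (H →L[ℂ] H)}
    {θ : (H →L[ℂ] H) → (H →L[ℂ] H)} :
    {a : H →L[ℂ] H | ∀ t ∈ pairs M j θ, a * t.2 = t.2 * a} =
      Set.centralizer (θ '' (M : Set (H →L[ℂ] H)) ∪ (j '' (θ '' (M : Set (H →L[ℂ] H))))) := by
  ext a
  constructor
  · rintro h _ (⟨x, hx, rfl⟩ | ⟨_, ⟨x, hx, rfl⟩, rfl⟩)
    · exact (h (x, θ x) ⟨x, hx, Or.inl rfl⟩).symm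
    · exact (h (j x, j (θ x)) ⟨x, hx, Or.inr rfl⟩).symm
  · rintro h _ ⟨x, hx, rfl | rfl⟩
    · exact (h (θ x) (Or.inl ⟨x, hx, rfl⟩)).symm
    · exact (h (j (θ x)) (Or.inr ⟨_, ⟨x, hx, rfl⟩, rfl⟩)).symm

section SF

variable {M : VonNeumannAlgebra H} {Ω : H} {J : H → H} {j : (H →L[ℂ] H) → (H →L[ℂ] H)}

lemma j_mul (hSF : StandardForm M Ω J j) (x y : H →L[ℂ] H) : j (x * y) = j x * j y := by
  ext ξ
  show j (x * y) ξ = j x (j y ξ)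
  rw [hSF.jdef, hSF.jdef, hSF.jdef, hSF.Jinvol]; rfl

lemma j_j (hSF : StandardForm M Ω J j) (x : H →L[ℂ] H) : j (j x) = x := by
  ext ξ
  rw [hSF.jdef, hSF.jdef, hSF.Jinvol, hSF.Jinvol]

lemma j_star (hSF : StandardForm M Ω J j) (x : H →L[ℂ] H) : j (star x) = star (j x) := by
  refine (ContinuousLinearMap.eq_adjoint_iff (j (star x)) (j x)).2 fun ξ η => ?_
  rw [hSF.jdef, hSF.jdef]
  conv_lhs => rw [← hSF.Jinvol η, hSF.Jinner]
  conv_rhs => rw [← hSF.Jinvol ξ, hSF.Jinner]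
  exact ContinuousLinearMap.adjoint_inner_right x (J η) (J ξ)

lemma centralizer_eq (hSF : StandardForm M Ω J j) (P : Set (H →L[ℂ] H)) :
    Set.centralizer (P ∪ (j '' P)) = Set.centralizer P ∩ (j '' Set.centralizer P) := by
  ext a
  constructor
  · intro h
    refine ⟨fun p hp => h p (Or.inl hp), j a, fun p hp => ?_, j_j hSF a⟩
    have := congrArg j (h (j p) (Or.inr ⟨p, hp, rfl⟩))
    rwa [j_mul hSF, j_mul hSF, j_j hSF] at this
  · rintro ⟨h1, b, hb, rfl⟩ _ (hp | ⟨p, hp, rfl⟩)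
    · exact h1 _ hp
    · rw [← j_mul hSF, ← j_mul hSF, hb p hp]

lemma setup_of (hSF : StandardForm M Ω J j) (hM : IsFactorSet (M : Set (H →L[ℂ] H)))
    {θ : (H →L[ℂ] H) → (H →L[ℂ] H)} (hθ : StateEndo M Ω θ)
    {u : H →L[ℂ] H} (hu : Implements M Ω θ u) (hequi : CommutesWithJ J u) :
    Setup (pairs M j θ) {a : H →L[ℂ] H | ∀ t ∈ pairs M j θ, a * t.2 = t.2 * a} u := by
  have hux : ∀ x ∈ M, u * x = θ x * u := by
    intro x hx
    have hd : Dense (Submodule.span ℂ {ξ : H | ∃ x ∈ M, x Ω = ξ} : Set H) :=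
      hSF.cyclic.mono Submodule.subset_span
    refine ContinuousLinearMap.ext_on hd ?_
    rintro _ ⟨y, hy, rfl⟩
    show u ((x * y) Ω) = θ x (u (y Ω))
    rw [hu.2 _ (mul_mem hx hy), hu.2 y hy, hθ.hom.map_mul x hx y hy]; rfl
  refine ⟨?_, ?_, fun a => Iff.rfl, ?_, ?_⟩
  · rintro _ ⟨x, hx, rfl | rfl⟩
    · exact ⟨star x, star_mem hx, Or.inl (by rw [hθ.hom.map_star x hx])⟩
    · exact ⟨star x, star_mem hx, Or.inr (by
        rw [hθ.hom.map_star x hx, j_star hSF, j_star hSF])⟩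
  · intro b hb
    have h1 : ∀ x ∈ M, b * x = x * b := fun x hx => hb (x, θ x) ⟨x, hx, Or.inl rfl⟩
    refine hM b ?_ h1
    rw [← M.centralizer_centralizer]
    intro y hy
    obtain ⟨x, hx, rfl⟩ := hSF.jsurj y hy
    exact (hb (j x, j (θ x)) ⟨x, hx, Or.inr rfl⟩).symm
  · rintro _ ⟨x, hx, rfl | rfl⟩
    · exact hux x hx
    · ext ξ
      show u (j x ξ) = j (θ x) (u ξ)
      rw [hSF.jdef, hSF.jdef, hequi, ← hequi ξ]
      exact congrArg J (DFunLike.congr_fun (hux x hx) (J ξ))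
  · exact (ContinuousLinearMap.norm_map_iff_adjoint_comp_self u).1 hu.1

end SF

/-- **Corollary 3.7.**  Let `θ` be an equi-modular endomorphism of the factor `M` in standard
form, with `P = θ(M) ⊆ M ⊆ P₁ = JP′J` the basic construction.  The following are equivalent:
(1) there is a unique unital normal `*`-endomorphism `θ⁽²⁾` of `B(L²(M,φ))` with
`θ⁽²⁾(x) = θ(x)` and `θ⁽²⁾(j(x)) = j(θ(x))` for `x ∈ M`;
(2) `P ∨ JPJ` is a factor (necessarily of type `I`);
(3) `(P ∨ JPJ)′ = P′ ∩ P₁` is a factor (necessarily of type `I`);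
(4) `{x ŷ : x ∈ P′ ∩ P₁, y ∈ P}` is total in `L²(M,φ)`. -/
theorem corollary_3_7
    (M : VonNeumannAlgebra H) (Ω : H) (J : H → H) (j : (H →L[ℂ] H) → (H →L[ℂ] H))
    (hSF : StandardForm M Ω J j) (hM : IsFactorSet (M : Set (H →L[ℂ] H)))
    (θ : (H →L[ℂ] H) → (H →L[ℂ] H)) (hθ : StateEndo M Ω θ)
    (u : H →L[ℂ] H) (hu : Implements M Ω θ u) (hequi : CommutesWithJ J u) :
    letI P : Set (H →L[ℂ] H) := θ '' (M : Set (H →L[ℂ] H))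
    letI A : Set (H →L[ℂ] H) := Set.centralizer P ∩ (j '' Set.centralizer P)
    -- `(P ∨ JPJ)′ = P′ ∩ P₁`:
    (Set.centralizer (P ∪ (j '' P)) = A) ∧
    -- (1) ↔ (2):
    (((∃! Θ : (H →L[ℂ] H) → (H →L[ℂ] H), IsExtension M j θ Θ)) ↔
      IsFactorSet (vN (P ∪ (j '' P)))) ∧
    -- (2) ↔ (3):
    (IsFactorSet (vN (P ∪ (j '' P))) ↔ IsFactorSet A) ∧
    -- (3) ↔ (4):
    (IsFactorSet A ↔
      Dense (Submodule.span ℂ {ξ : H | ∃ a ∈ A, ∃ y ∈ P, a (y Ω) = ξ} : Set H)) ∧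
    -- in the factor case, the factors are necessarily of type `I`:
    (IsFactorSet (vN (P ∪ (j '' P))) → IsTypeIFactorSet (vN (P ∪ (j '' P)))) ∧
    (IsFactorSet A → IsTypeIFactorSet A) := by
  have hnt : Nontrivial H := ⟨⟨Ω, 0, fun h0 => by
    have := hSF.unit
    rw [h0, norm_zero] at this
    exact zero_ne_one this⟩⟩
  set P : Set (H →L[ℂ] H) := θ '' (M : Set (H →L[ℂ] H)) with hP
  set A : Set (H →L[ℂ] H) := Set.centralizer P ∩ (j '' Set.centralizer P) with hAdef
  have hset := setup_of hSF hM hθ hu hequi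
  have hcent : Set.centralizer (P ∪ (j '' P)) = A := centralizer_eq hSF P
  have hA : {a : H →L[ℂ] H | ∀ t ∈ pairs M j θ, a * t.2 = t.2 * a} = A := by
    rw [← hcent]
    exact memA_iff
  rw [hA] at hset
  have hvN : vN (P ∪ (j '' P)) = Set.centralizer A := by rw [vN, hcent]
  have h23 : IsFactorSet (vN (P ∪ (j '' P))) ↔ IsFactorSet A := by
    have hAA : Set.centralizer (Set.centralizer A) = A := by
      rw [← hcent, Set.centralizer_centralizer_centralizer]
    rw [hvN]
    constructor
    · intro hf x hx hc
      exact hf x (fun a ha => (hc a ha).symm) (fun y hy => hy x hx)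
    · intro hf x hx hc
      refine hf x ?_ (fun y hy => (hx y hy).symm)
      rw [← hAA]
      exact fun y hy => (hc y hy).symm
  have h3d : IsFactorSet A ↔
      Dense (Submodule.span ℂ (rngs {w | Intw (pairs M j θ) w}) : Set H) :=
    ⟨hset.dense_of_factor, hset.factor_of_dense⟩
  have hext : ∀ Θ, IsExtension M j θ Θ ↔ AbsExt (pairs M j θ) Θ := ext_iff
  have h1d : (∃! Θ : (H →L[ℂ] H) → (H →L[ℂ] H), IsExtension M j θ Θ) ↔
      Dense (Submodule.span ℂ (rngs {w | Intw (pairs M j θ) w}) : Set H) := by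
    constructor
    · rintro ⟨Θ, hΘ, _⟩
      exact Setup.dense_of_ext ((hext Θ).1 hΘ)
    · intro hd
      obtain ⟨Θ, hΘ⟩ := hset.exists_ext hd
      exact ⟨Θ, (hext Θ).2 hΘ, fun Θ' hΘ' => hset.ext_unique ((hext Θ').1 hΘ') hΘ⟩
  refine ⟨hcent, h1d.trans (h3d.symm.trans h23.symm), h23, h3d.trans ?_, ?_, hset.typeI⟩
  · constructor
    · intro hd
      have hle : (Submodule.span ℂ (rngs {w | Intw (pairs M j θ) w})).topologicalClosure ≤
          (Submodule.span ℂ {ξ : H | ∃ a ∈ A, ∃ y ∈ P, a (y Ω) = ξ}).topologicalClosure := by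
        refine Submodule.topologicalClosure_minimal _ ?_
          (Submodule.isClosed_topologicalClosure _)
        rw [Submodule.span_le]
        rintro _ ⟨w, hw, η, rfl⟩
        have hη : η ∈ closure {ξ : H | ∃ x ∈ M, x Ω = ξ} := hSF.cyclic η
        refine map_mem_closure w.continuous hη ?_
        rintro _ ⟨x, hx, rfl⟩
        refine Submodule.subset_span ⟨w * star u, hset.memA' hw hset.intu, θ x, ⟨x, hx, rfl⟩, ?_⟩
        rw [← hu.2 x hx]
        have : w * star u * u = w := by rw [mul_assoc, hset.isou, mul_one]
        exact DFunLike.congr_fun this (x Ω)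
      rw [Submodule.dense_iff_topologicalClosure_eq_top] at hd ⊢
      rw [hd] at hle
      exact top_le_iff.1 hle
    · intro hd
      refine hd.mono ?_
      apply Submodule.span_mono
      rintro _ ⟨a, ha, _, ⟨x, hx, rfl⟩, rfl⟩
      refine ⟨a * u, hset.amul ha hset.intu, x Ω, ?_⟩
      rw [← hu.2 x hx]; rfl
  · intro hf
    obtain ⟨Θ, hΘ⟩ := hset.exists_ext (h3d.1 (h23.1 hf))
    rw [hvN] at hf ⊢
    exact hset.typeI' hΘ hf

end Paper
end
end
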